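/- Let α, β > 0, let μ be the Beta distribution with parameters α and β (density x^{α−1}(1−x)^{β−1}/B(α,β) on (0,1)), let θ have law μ, and let X̄_n have law P[X̄_n = k/n] = C(n,k) ∫_0^1 t^k (1-t)^{n-k} μ(dt). Then for every n ≥ 1, d_W(X̄_n, θ) ≤ C_{α,β}/n, where C_{α,β} = (B(α+2,β) + B(α,β+2))/B(α,β) + E|2θ − 1| + E|(α+β−2)θ + (1−α)| + 3/√(2πe), and B denotes the Beta function B(α,β) = ∫_0^1 t^{α−1}(1−t)^{β−1} dt. -/

import Mathlib

open MeasureTheory ProbabilityTheory Set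

/-- Wasserstein distance between two laws on ℝ (dual formulation):
`d_W(μ,ν) = sup over 1-Lipschitz φ of |∫φ dμ - ∫φ dν|`. -/
noncomputable def dW (μ ν : Measure ℝ) : ℝ :=
  ⨆ φ : {f : ℝ → ℝ // LipschitzWith 1 f}, |(∫ x, φ.1 x ∂μ) - ∫ x, φ.1 x ∂ν|

/-- Law of the empirical mean `X̄ₙ` of the first `n` terms of an exchangeable 0-1 sequence
with de Finetti mixing measure `μ` : `P[X̄ₙ = k/n] = C(n,k) ∫ t^k (1-t)^(n-k) dμ(t)`. -/
noncomputable def barLaw (μ : Measure ℝ) (n : ℕ) : Measure ℝ :=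
  ∑ k ∈ Finset.range (n + 1),
    (ENNReal.ofReal ((n.choose k : ℝ) * ∫ t, t ^ k * (1 - t) ^ (n - k) ∂μ)) •
      Measure.dirac ((k : ℝ) / n)

/-- The Beta function `B(α,β) = ∫₀¹ t^(α-1) (1-t)^(β-1) dt`. -/
noncomputable def betaFun (α β : ℝ) : ℝ :=
  ∫ t in Set.Ioo (0 : ℝ) 1, t ^ (α - 1) * (1 - t) ^ (β - 1)

/-- The Beta distribution with parameters `α β`, with density
`x^(α-1)(1-x)^(β-1)/B(α,β)` on `(0,1)`. -/
noncomputable def betaM (α β : ℝ) : Measure ℝ :=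
  (volume.restrict (Set.Ioo 0 1)).withDensity
    fun x => ENNReal.ofReal (x ^ (α - 1) * (1 - x) ^ (β - 1) / betaFun α β)

/-- The primitive, vanishing at `0`, of the Bernstein polynomial of degree `n` and index `j`. -/
noncomputable def bernsteinPrim (n j : ℕ) (t : ℝ) : ℝ :=
  (∑ i ∈ Finset.Ico (j + 1) (n + 2), (bernsteinPolynomial ℝ (n + 1) i).eval t) / (n + 1)

/-- The length of `[j / N, (j + 1) / N] ∩ (-∞, t]`. -/
noncomputable def cellLength (N j : ℕ) (t : ℝ) : ℝ :=
  min t ((j + 1 : ℕ) / N) - min t (j / N)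

/-- The indicator of the open cell `(j / N, (j + 1) / N)`. -/
noncomputable def cellIndicator (N j : ℕ) : ℝ → ℝ :=
  (Ioo ((j : ℝ) / N) ((j + 1 : ℕ) / N)).indicator 1

lemma eval_bernsteinPolynomial (n j : ℕ) (t : ℝ) :
    (bernsteinPolynomial ℝ n j).eval t = n.choose j * t ^ j * (1 - t) ^ (n - j) := by
  simp [bernsteinPolynomial]

lemma eval_bernsteinPolynomial_nonneg (n j : ℕ) {t : ℝ} (ht : t ∈ Icc (0 : ℝ) 1) :
    0 ≤ (bernsteinPolynomial ℝ n j).eval t := by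
  have h0 := ht.1
  have h1 : 0 ≤ 1 - t := sub_nonneg.2 ht.2
  rw [eval_bernsteinPolynomial]
  positivity

lemma sum_eval_bernsteinPolynomial (n : ℕ) (t : ℝ) :
    ∑ j ∈ Finset.range (n + 1), (bernsteinPolynomial ℝ n j).eval t = 1 := by
  rw [← Polynomial.eval_finsetSum, bernsteinPolynomial.sum, Polynomial.eval_one]

lemma sum_mul_eval_bernsteinPolynomial (n : ℕ) (t : ℝ) :
    ∑ j ∈ Finset.range (n + 1), (j : ℝ) * (bernsteinPolynomial ℝ n j).eval t = n * t := by
  have h := congrArg (Polynomial.eval t) (bernsteinPolynomial.sum_smul ℝ n)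
  simpa [Polynomial.eval_finsetSum] using h

lemma sum_mul_pred_mul_eval_bernsteinPolynomial (n : ℕ) (t : ℝ) :
    ∑ j ∈ Finset.range (n + 2), (j : ℝ) * (j - 1) * (bernsteinPolynomial ℝ (n + 1) j).eval t =
      (n + 1) * n * t ^ 2 := by
  have h := congrArg (Polynomial.eval t) (bernsteinPolynomial.sum_mul_smul ℝ (n + 1))
  simp only [Polynomial.eval_finsetSum, Polynomial.eval_smul, Polynomial.eval_pow,
    Polynomial.eval_X, Nat.cast_mul, Nat.cast_add, Nat.cast_one,
    add_tsub_cancel_right, ← Nat.cast_smul_eq_nsmul ℝ, smul_eq_mul] at h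
  rw [← h]
  refine Finset.sum_congr rfl fun j _ ↦ ?_
  cases j <;> simp

lemma bernsteinPrim_nonneg (n j : ℕ) {t : ℝ} (ht : t ∈ Icc (0 : ℝ) 1) :
    0 ≤ bernsteinPrim n j t :=
  div_nonneg (Finset.sum_nonneg fun i _ ↦ eval_bernsteinPolynomial_nonneg _ i ht) (by positivity)

lemma bernsteinPrim_le (n j : ℕ) {t : ℝ} (ht : t ∈ Icc (0 : ℝ) 1) :
    bernsteinPrim n j t ≤ 1 / (n + 1) := by
  unfold bernsteinPrim
  gcongr
  rw [← sum_eval_bernsteinPolynomial (n + 1) t]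
  refine Finset.sum_le_sum_of_subset_of_nonneg ?_ fun i _ _ ↦
    eval_bernsteinPolynomial_nonneg _ i ht
  rw [Finset.range_eq_Ico]
  exact Finset.Ico_subset_Ico_left (Nat.zero_le _)

lemma sum_mul_bernsteinPrim (n : ℕ) (a : ℕ → ℝ) (t : ℝ) :
    ∑ j ∈ Finset.range (n + 1), a j * bernsteinPrim n j t =
      (∑ i ∈ Finset.range (n + 2), (∑ j ∈ Finset.range i, a j) *
        (bernsteinPolynomial ℝ (n + 1) i).eval t) / (n + 1) := by
  simp only [bernsteinPrim, mul_div_assoc', ← Finset.sum_div, Finset.mul_sum, Finset.sum_mul]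
  congr 1
  refine Finset.sum_comm' fun j i ↦ ?_
  simp only [Finset.mem_range, Finset.mem_Ico]
  omega

lemma sum_bernsteinPrim (n : ℕ) (t : ℝ) :
    ∑ j ∈ Finset.range (n + 1), bernsteinPrim n j t = t := by
  have h := sum_mul_bernsteinPrim n (fun _ ↦ 1) t
  have h' := sum_mul_eval_bernsteinPolynomial (n + 1) t
  simp only [one_mul, Finset.sum_const, Finset.card_range, nsmul_eq_mul, mul_one] at h
  rw [h, h']
  push_cast
  field_simp

lemma sum_cast_mul_bernsteinPrim (n : ℕ) (t : ℝ) :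
    ∑ j ∈ Finset.range (n + 1), (j : ℝ) * bernsteinPrim n j t = n * t ^ 2 / 2 := by
  have hsum (i : ℕ) : ∑ j ∈ Finset.range i, (j : ℝ) = i * (i - 1) / 2 := by
    induction i with
    | zero => simp
    | succ i ih => rw [Finset.sum_range_succ, ih]; push_cast; ring
  rw [sum_mul_bernsteinPrim]
  simp only [hsum, div_mul_eq_mul_div, ← Finset.sum_div]
  rw [sum_mul_pred_mul_eval_bernsteinPolynomial]
  field_simp

lemma hasDerivAt_bernsteinPrim {n j : ℕ} (hj : j ≤ n) (t : ℝ) :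
    HasDerivAt (bernsteinPrim n j) ((bernsteinPolynomial ℝ n j).eval t) t := by
  have h : HasDerivAt (fun t ↦ ∑ i ∈ Finset.Ico (j + 1) (n + 2),
      (bernsteinPolynomial ℝ (n + 1) i).eval t)
      (∑ i ∈ Finset.Ico (j + 1) (n + 2),
        (Polynomial.derivative (bernsteinPolynomial ℝ (n + 1) i)).eval t) t :=
    HasDerivAt.fun_sum fun i _ ↦ Polynomial.hasDerivAt _ _
  refine (h.div_const ((n : ℝ) + 1)).congr_deriv ?_
  rw [← Finset.sum_Ico_add' _ j (n + 1) 1]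
  have h2 := Finset.sum_Ico_sub (fun i ↦ (bernsteinPolynomial ℝ n i).eval t)
    (show j ≤ n + 1 by omega)
  rw [bernsteinPolynomial.eq_zero_of_lt ℝ (Nat.lt_succ_self n)] at h2
  simp only [Polynomial.eval_zero, zero_sub] at h2
  simp only [bernsteinPolynomial.derivative_succ_aux, Polynomial.eval_mul, Polynomial.eval_sub,
    Polynomial.eval_add, Polynomial.eval_natCast, Polynomial.eval_one, ← Finset.mul_sum]
  rw [mul_div_cancel_left₀ _ (by positivity), ← neg_neg (Polynomial.eval t _), ← h2,
    ← Finset.sum_neg_distrib]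
  simp

lemma sum_cellLength {n : ℕ} {t : ℝ} (ht : t ∈ Icc (0 : ℝ) 1) :
    ∑ j ∈ Finset.range (n + 1), cellLength (n + 1) j t = t := by
  unfold cellLength
  rw [Finset.sum_range_sub fun j : ℕ ↦ min t ((j : ℝ) / (n + 1 : ℕ))]
  rw [div_self (by positivity)]
  simp [ht.1, ht.2]

lemma le_sum_mul_cellLength {n : ℕ} {t : ℝ} (ht : t ∈ Icc (0 : ℝ) 1) :
    (n + 1) * t ^ 2 / 2 - t / 2 ≤
      ∑ j ∈ Finset.range (n + 1), (j : ℝ) * cellLength (n + 1) j t := by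
  set g : ℕ → ℝ := fun j ↦ min t ((j : ℝ) / (n + 1 : ℕ)) with hg
  have hN : (0 : ℝ) < (n + 1 : ℕ) := by positivity
  have htel := Finset.sum_range_sub (fun j ↦ (n + 1) * g j ^ 2 / 2 - g j / 2) (n + 1)
  have hend : g (n + 1) = t := by simp only [hg, div_self hN.ne', ht.2, min_eq_left]
  have hzero : g 0 = 0 := by simp [hg, ht.1]
  simp only [hend, hzero] at htel
  calc (n + 1) * t ^ 2 / 2 - t / 2 = _ := by rw [htel]; ring
    _ ≤ _ := Finset.sum_le_sum fun j _ ↦ ?_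
  have h1 : g j ≤ g (j + 1) := by
    simp only [hg]; gcongr; omega
  have h2 : (n + 1 : ℕ) * g j ≤ j := by
    rw [mul_comm, ← le_div_iff₀ hN]; exact min_le_right _ _
  have h3 : (n + 1 : ℕ) * g (j + 1) ≤ (j + 1 : ℕ) := by
    rw [mul_comm, ← le_div_iff₀ hN]; exact min_le_right _ _
  change _ ≤ (j : ℝ) * (g (j + 1) - g j)
  push_cast at h2 h3
  nlinarith [mul_nonneg (sub_nonneg.2 h1) (show 0 ≤ 2 * (j : ℝ) + 1 -
    ((n + 1) * g j + (n + 1) * g (j + 1)) by linarith)]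

lemma cellLength_of_le {N j : ℕ} {t : ℝ} (h : ((j + 1 : ℕ) : ℝ) / N ≤ t) :
    cellLength N j t = 1 / N := by
  have h' : (j : ℝ) / N ≤ ((j + 1 : ℕ) : ℝ) / N := by gcongr; omega
  rw [cellLength, min_eq_right h, min_eq_right (h'.trans h)]
  push_cast
  ring

lemma cellLength_of_ge {N j : ℕ} {t : ℝ} (h : t ≤ (j : ℝ) / N) : cellLength N j t = 0 := by
  have h' : (j : ℝ) / N ≤ ((j + 1 : ℕ) : ℝ) / N := by gcongr; omega
  rw [cellLength, min_eq_left h, min_eq_left (h.trans h'), sub_self]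

lemma exists_cell (n : ℕ) {t : ℝ} (ht : t ∈ Icc (0 : ℝ) 1) :
    ∃ J ≤ n, (J : ℝ) / (n + 1 : ℕ) ≤ t ∧ t ≤ ((J + 1 : ℕ) : ℝ) / (n + 1 : ℕ) := by
  have hN : (0 : ℝ) < (n + 1 : ℕ) := by positivity
  rcases ht.2.eq_or_lt with rfl | h1
  · refine ⟨n, le_rfl, ?_, by rw [div_self hN.ne']⟩
    rw [div_le_one hN]
    simp
  · have h0 : 0 ≤ t * (n + 1 : ℕ) := mul_nonneg ht.1 hN.le
    refine ⟨⌊t * (n + 1 : ℕ)⌋₊, ?_, ?_, ?_⟩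
    · refine Nat.lt_succ_iff.1 ((Nat.floor_lt h0).2 ?_)
      nlinarith
    · rw [div_le_iff₀ hN]
      exact Nat.floor_le h0
    · rw [le_div_iff₀ hN]
      exact_mod_cast (Nat.lt_floor_add_one _).le

/-- The primitive of the difference between the Bernstein polynomial with coefficients `a` and the
step function with values `a` on a regular grid of `n + 1` cells. -/
noncomputable def bernsteinGap (n : ℕ) (a : ℕ → ℝ) (t : ℝ) : ℝ :=
  ∑ j ∈ Finset.range (n + 1), a j * (bernsteinPrim n j t - cellLength (n + 1) j t)

lemma bernsteinGap_nonneg {n : ℕ} {a : ℕ → ℝ} (ha : Monotone a) {t : ℝ}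
    (ht : t ∈ Icc (0 : ℝ) 1) : 0 ≤ bernsteinGap n a t := by
  obtain ⟨J, -, hJ1, hJ2⟩ := exists_cell n ht
  have hsum : ∑ j ∈ Finset.range (n + 1), a J * (bernsteinPrim n j t - cellLength (n + 1) j t)
      = 0 := by
    rw [← Finset.mul_sum, Finset.sum_sub_distrib, sum_bernsteinPrim, sum_cellLength ht, sub_self,
      mul_zero]
  rw [← hsum]
  refine Finset.sum_le_sum fun j _ ↦ ?_
  rcases lt_trichotomy j J with h | rfl | h
  · have hc : cellLength (n + 1) j t = 1 / (n + 1 : ℕ) :=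
      cellLength_of_le (le_trans (by gcongr; omega) hJ1)
    have hb := bernsteinPrim_le n j ht
    refine mul_le_mul_of_nonpos_right (ha h.le) ?_
    rw [hc]
    push_cast
    linarith
  · rfl
  · have hc : cellLength (n + 1) j t = 0 :=
      cellLength_of_ge (hJ2.trans (by gcongr; omega))
    refine mul_le_mul_of_nonneg_right (ha h.le) ?_
    rw [hc, sub_zero]
    exact bernsteinPrim_nonneg n j ht

lemma bernsteinGap_cast_le {n : ℕ} {t : ℝ} (ht : t ∈ Icc (0 : ℝ) 1) :
    bernsteinGap n (fun j ↦ (j : ℝ)) t ≤ t * (1 - t) / 2 := by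
  have h := le_sum_mul_cellLength (n := n) ht
  simp only [bernsteinGap, mul_sub, Finset.sum_sub_distrib, sum_cast_mul_bernsteinPrim]
  linarith

lemma abs_bernsteinGap_le {n : ℕ} {a : ℕ → ℝ} {δ : ℝ} (hδ : 0 ≤ δ)
    (ha : ∀ j, |a (j + 1) - a j| ≤ δ) {t : ℝ} (ht : t ∈ Icc (0 : ℝ) 1) :
    |bernsteinGap n a t| ≤ δ * (t * (1 - t) / 2) := by
  have hp : 0 ≤ bernsteinGap n (fun j ↦ δ * j + a j) t := by
    refine bernsteinGap_nonneg (monotone_nat_of_le_succ fun j ↦ ?_) ht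
    have := (abs_le.1 (ha j)).1
    push_cast
    linarith
  have hm : 0 ≤ bernsteinGap n (fun j ↦ δ * j - a j) t := by
    refine bernsteinGap_nonneg (monotone_nat_of_le_succ fun j ↦ ?_) ht
    have := (abs_le.1 (ha j)).2
    push_cast
    linarith
  have hid := mul_le_mul_of_nonneg_left (bernsteinGap_cast_le (n := n) ht) hδ
  simp only [bernsteinGap, add_mul, sub_mul, Finset.sum_add_distrib, Finset.sum_sub_distrib,
    mul_assoc, ← Finset.mul_sum] at hp hm hid ⊢
  rw [abs_le]
  constructor <;> linarith

lemma continuous_bernsteinGap (n : ℕ) (a : ℕ → ℝ) : Continuous (bernsteinGap n a) := by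
  unfold bernsteinGap bernsteinPrim cellLength
  fun_prop

lemma hasDerivAt_cellLength {N j : ℕ} {t : ℝ} (h0 : t ≠ (j : ℝ) / N)
    (h1 : t ≠ ((j + 1 : ℕ) : ℝ) / N) :
    HasDerivAt (cellLength N j) (cellIndicator N j t) t := by
  have hle : (j : ℝ) / N ≤ ((j + 1 : ℕ) : ℝ) / N := by gcongr; omega
  have key (c : ℝ) (h : t ≠ c) :
      HasDerivAt (fun s ↦ min s c) (if t < c then 1 else 0) t := by
    rcases h.lt_or_gt with h | h
    · rw [if_pos h]
      refine (hasDerivAt_id t).congr_of_eventuallyEq ?_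
      filter_upwards [Iio_mem_nhds h] with s hs using min_eq_left (le_of_lt hs)
    · rw [if_neg h.not_gt]
      refine (hasDerivAt_const t c).congr_of_eventuallyEq ?_
      filter_upwards [Ioi_mem_nhds h] with s hs using min_eq_right (le_of_lt hs)
  refine ((key _ h1).sub (key _ h0)).congr_deriv ?_
  by_cases hA : t < (j : ℝ) / N
  · rw [cellIndicator, indicator_of_notMem (fun h ↦ hA.not_gt h.1), if_pos hA,
      if_pos (hA.trans_le hle), sub_self]
  · have hA' : (j : ℝ) / N < t := lt_of_le_of_ne (not_lt.1 hA) h0.symm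
    by_cases hB : t < ((j + 1 : ℕ) : ℝ) / N
    · rw [cellIndicator, indicator_of_mem (by exact ⟨hA', hB⟩), if_pos hB, if_neg hA]
      simp
    · rw [cellIndicator, indicator_of_notMem (fun h ↦ hB h.2), if_neg hB, if_neg hA]
      simp

lemma hasDerivAt_bernsteinGap {n : ℕ} (a : ℕ → ℝ) {t : ℝ}
    (ht : t ∉ range fun j : ℕ ↦ (j : ℝ) / (n + 1 : ℕ)) :
    HasDerivAt (bernsteinGap n a) (∑ j ∈ Finset.range (n + 1),
      a j * ((bernsteinPolynomial ℝ n j).eval t - cellIndicator (n + 1) j t)) t := by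
  refine HasDerivAt.fun_sum fun j hj ↦ HasDerivAt.const_mul _ (HasDerivAt.sub ?_ ?_)
  · exact hasDerivAt_bernsteinPrim (Nat.lt_succ_iff.1 (Finset.mem_range.1 hj)) t
  · exact hasDerivAt_cellLength (fun h ↦ ht ⟨j, h.symm⟩) (fun h ↦ ht ⟨j + 1, h.symm⟩)

lemma abs_sum_cellIndicator_sub_le {n : ℕ} (hn : 1 ≤ n) {φ : ℝ → ℝ} (hφ : LipschitzWith 1 φ)
    {t : ℝ} (ht : t ∈ Icc (0 : ℝ) 1) (hgrid : t ∉ range fun j : ℕ ↦ (j : ℝ) / (n + 1 : ℕ)) :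
    |∑ j ∈ Finset.range (n + 1), φ (j / n) * cellIndicator (n + 1) j t - φ t| ≤ 1 / n := by
  obtain ⟨J, hJn, hJ1, hJ2⟩ := exists_cell n ht
  have hJ1' : (J : ℝ) / (n + 1 : ℕ) < t := lt_of_le_of_ne hJ1 fun h ↦ hgrid ⟨J, h⟩
  have hJ2' : t < ((J + 1 : ℕ) : ℝ) / (n + 1 : ℕ) :=
    lt_of_le_of_ne hJ2 fun h ↦ hgrid ⟨J + 1, h.symm⟩
  have hsum : ∑ j ∈ Finset.range (n + 1), φ (j / n) * cellIndicator (n + 1) j t = φ (J / n) := by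
    rw [Finset.sum_eq_single_of_mem J (Finset.mem_range.2 (by omega))]
    · rw [cellIndicator, indicator_of_mem (by exact ⟨hJ1', hJ2'⟩)]
      simp
    · intro j _ hj
      rw [cellIndicator, indicator_of_notMem, mul_zero]
      rintro ⟨h1, h2⟩
      have hlt {x y : ℕ} (h : (x : ℝ) / (n + 1 : ℕ) < (y : ℝ) / (n + 1 : ℕ)) : x < y := by
        rwa [div_lt_div_iff_of_pos_right (by positivity), Nat.cast_lt] at h
      have h3 := hlt (h1.trans hJ2')
      have h4 := hlt (hJ1'.trans h2)
      omega
  rw [hsum]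
  have hL := hφ.dist_le_mul (J / n) t
  rw [NNReal.coe_one, one_mul, Real.dist_eq, Real.dist_eq] at hL
  refine hL.trans ?_
  have hn' : (0 : ℝ) < n := by exact_mod_cast hn
  have hJn' : (J : ℝ) ≤ n := by exact_mod_cast hJn
  have hJ0 : (0 : ℝ) ≤ J := by positivity
  have hJd : (J : ℝ) / n * n = J := div_mul_cancel₀ _ hn'.ne'
  push_cast at hJ1 hJ2
  rw [div_le_iff₀ (by positivity)] at hJ1
  rw [le_div_iff₀ (by positivity)] at hJ2
  have h0 := ht.1
  have h1 := ht.2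
  rw [le_div_iff₀ hn', ← abs_of_pos hn', ← abs_mul, abs_of_pos hn', sub_mul, hJd, abs_le]
  constructor <;> linarith

/-- The unnormalised Beta density. -/
noncomputable def betaWeight (α β x : ℝ) : ℝ := x ^ (α - 1) * (1 - x) ^ (β - 1)

lemma betaWeight_pos (α β : ℝ) {x : ℝ} (hx : x ∈ Ioo (0 : ℝ) 1) : 0 < betaWeight α β x :=
  mul_pos (Real.rpow_pos_of_pos hx.1 _) (Real.rpow_pos_of_pos (sub_pos.2 hx.2) _)

lemma measurable_betaWeight (α β : ℝ) : Measurable (betaWeight α β) := by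
  unfold betaWeight
  fun_prop

lemma integrableOn_betaWeight {α β : ℝ} (hα : 0 < α) (hβ : 0 < β) :
    IntegrableOn (betaWeight α β) (Ioo 0 1) := by
  have h := (Complex.betaIntegral_convergent (u := α) (v := β) (by simpa) (by simpa)).norm
  rw [intervalIntegrable_iff_integrableOn_Ioo_of_le zero_le_one] at h
  refine h.congr_fun (fun x hx ↦ ?_) measurableSet_Ioo
  have hx' : 0 < 1 - x := sub_pos.2 hx.2
  have h2 := Complex.norm_cpow_eq_rpow_re_of_pos hx' ((β : ℂ) - 1)
  push_cast at h2
  simp only [norm_mul, Complex.norm_cpow_eq_rpow_re_of_pos hx.1, h2]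
  simp [betaWeight]

lemma betaFun_eq_integral_betaWeight (α β : ℝ) :
    betaFun α β = ∫ x in Ioo (0 : ℝ) 1, betaWeight α β x := rfl

lemma betaFun_pos {α β : ℝ} (hα : 0 < α) (hβ : 0 < β) : 0 < betaFun α β := by
  rw [betaFun_eq_integral_betaWeight, ← integral_Ioc_eq_integral_Ioo,
    ← intervalIntegral.integral_of_le zero_le_one]
  refine intervalIntegral.intervalIntegral_pos_of_pos_on ?_ (fun x hx ↦ betaWeight_pos α β hx)
    zero_lt_one
  rw [intervalIntegrable_iff_integrableOn_Ioo_of_le zero_le_one]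
  exact integrableOn_betaWeight hα hβ

lemma integral_betaM {α β : ℝ} (hα : 0 < α) (hβ : 0 < β) (g : ℝ → ℝ) :
    ∫ x, g x ∂(betaM α β) = (∫ x in Ioo (0 : ℝ) 1, g x * betaWeight α β x) / betaFun α β := by
  have hB := betaFun_pos hα hβ
  have hmeas : Measurable fun x : ℝ ↦
      ENNReal.ofReal (x ^ (α - 1) * (1 - x) ^ (β - 1) / betaFun α β) :=
    ((measurable_betaWeight α β).div_const _).ennreal_ofReal
  rw [betaM, integral_withDensity_eq_integral_toReal_smul hmeas (by simp), ← integral_div]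
  refine setIntegral_congr_fun measurableSet_Ioo fun x hx ↦ ?_
  have hw := betaWeight_pos α β hx
  change (ENNReal.ofReal (betaWeight α β x / betaFun α β)).toReal • g x = _
  rw [ENNReal.toReal_ofReal (by positivity), smul_eq_mul]
  ring

lemma integrableOn_continuous_mul_betaWeight {α β : ℝ} (hα : 0 < α) (hβ : 0 < β) {g : ℝ → ℝ}
    (hg : Continuous g) : IntegrableOn (fun x ↦ g x * betaWeight α β x) (Ioo 0 1) := by
  obtain ⟨c, hc⟩ := isCompact_Icc.exists_bound_of_continuousOn (s := Icc (0 : ℝ) 1)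
    hg.continuousOn
  exact (integrableOn_betaWeight hα hβ).bdd_mul hg.aestronglyMeasurable
    ((ae_restrict_mem measurableSet_Ioo).mono fun x hx ↦ hc x (Ioo_subset_Icc_self hx))

lemma hasDerivAt_betaWeight (α β : ℝ) {x : ℝ} (hx : x ∈ Ioo (0 : ℝ) 1) :
    HasDerivAt (betaWeight α β)
      (betaWeight α β x * ((α - 1) / x - (β - 1) / (1 - x))) x := by
  have h0 : x ≠ 0 := hx.1.ne'
  have h1 : 1 - x ≠ 0 := (sub_pos.2 hx.2).ne'
  have hd := (Real.hasDerivAt_rpow_const (p := α - 1) (Or.inl h0)).mul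
    (((hasDerivAt_id x).const_sub 1).rpow_const (p := β - 1) (Or.inl h1))
  refine hd.congr_deriv ?_
  simp only [betaWeight, id, Real.rpow_sub_one h0, Real.rpow_sub_one h1]
  ring

lemma mul_one_sub_mul_betaWeight {α β x : ℝ} (hx : x ∈ Ioo (0 : ℝ) 1) :
    x * (1 - x) * betaWeight α β x = x ^ α * (1 - x) ^ β := by
  have h0 : x ≠ 0 := hx.1.ne'
  have h1 : 1 - x ≠ 0 := (sub_pos.2 hx.2).ne'
  rw [betaWeight, Real.rpow_sub_one h0, Real.rpow_sub_one h1]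
  field_simp

/-- Integration by parts against the Beta density, for a function vanishing at `0` and `1`. -/
lemma abs_integral_deriv_mul_betaWeight_le {α β : ℝ} (hα : 0 < α) (hβ : 0 < β) {Γ γ : ℝ → ℝ}
    {c M : ℝ} {s : Set ℝ} (hs : s.Countable) (hΓ : Continuous Γ)
    (hΓ' : ∀ x ∈ Ioo (0 : ℝ) 1 \ s, HasDerivAt Γ (γ x) x)
    (hΓc : ∀ x ∈ Icc (0 : ℝ) 1, |Γ x| ≤ c * (x * (1 - x))) (hγ : Measurable γ)
    (hγM : ∀ x ∈ Ioo (0 : ℝ) 1, |γ x| ≤ M) :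
    |∫ x in Ioo (0 : ℝ) 1, γ x * betaWeight α β x| ≤
      c * ∫ x in Ioo (0 : ℝ) 1, |(α + β - 2) * x + (1 - α)| * betaWeight α β x := by
  set w' : ℝ → ℝ := fun x ↦ betaWeight α β x * ((α - 1) / x - (β - 1) / (1 - x)) with hw'
  have hwint := integrableOn_betaWeight hα hβ
  have hdom : IntegrableOn (fun x ↦ |(α + β - 2) * x + (1 - α)| * betaWeight α β x) (Ioo 0 1) :=
    integrableOn_continuous_mul_betaWeight hα hβ (by fun_prop)
  have hbound (x : ℝ) (hx : x ∈ Ioo (0 : ℝ) 1) :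
      |Γ x * w' x| ≤ c * (|(α + β - 2) * x + (1 - α)| * betaWeight α β x) := by
    have hw := betaWeight_pos α β hx
    have h0 := hx.1
    have h1 : 0 < 1 - x := sub_pos.2 hx.2
    have hmul : x * (1 - x) * w' x = -((α + β - 2) * x + (1 - α)) * betaWeight α β x := by
      simp only [hw']
      field_simp
      ring
    calc |Γ x * w' x| = |Γ x| * |w' x| := abs_mul _ _
      _ ≤ c * (x * (1 - x)) * |w' x| :=
          mul_le_mul_of_nonneg_right (hΓc x (Ioo_subset_Icc_self hx)) (abs_nonneg _)
      _ = c * |x * (1 - x) * w' x| := by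
          rw [abs_mul (x * (1 - x)), abs_of_pos (mul_pos h0 h1), mul_assoc]
      _ = _ := by rw [hmul, abs_mul, abs_neg, abs_of_pos hw]
  have hγw : IntegrableOn (fun x ↦ γ x * betaWeight α β x) (Ioo 0 1) :=
    hwint.bdd_mul hγ.aestronglyMeasurable ((ae_restrict_mem measurableSet_Ioo).mono hγM)
  have hΓw' : IntegrableOn (fun x ↦ Γ x * w' x) (Ioo 0 1) := by
    refine (hdom.const_mul c).mono' ?_ ((ae_restrict_mem measurableSet_Ioo).mono hbound)
    have := measurable_betaWeight α β
    exact (hΓ.measurable.mul (by fun_prop)).aestronglyMeasurable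
  have hΓ0 : Γ 0 = 0 := by simpa using hΓc 0 (by simp)
  have hΓ1 : Γ 1 = 0 := by simpa using hΓc 1 (by simp)
  have hprod (x : ℝ) (hx : x ∈ Icc (0 : ℝ) 1) :
      ‖Γ x * betaWeight α β x‖ ≤ c * (x ^ α * (1 - x) ^ β) := by
    rcases hx.1.eq_or_lt with rfl | h0
    · simp [hΓ0, hα.ne']
    rcases hx.2.eq_or_lt with rfl | h1
    · simp [hΓ1, hβ.ne']
    rw [← mul_one_sub_mul_betaWeight ⟨h0, h1⟩, norm_mul, Real.norm_eq_abs, Real.norm_eq_abs,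
      abs_of_pos (betaWeight_pos α β ⟨h0, h1⟩), ← mul_assoc]
    exact mul_le_mul_of_nonneg_right (hΓc x hx) (betaWeight_pos α β ⟨h0, h1⟩).le
  have hcont : ContinuousOn (fun x ↦ Γ x * betaWeight α β x) (Icc 0 1) := by
    have hlim : Continuous fun x : ℝ ↦ c * (x ^ α * (1 - x) ^ β) := by
      have h1 := Real.continuous_rpow_const hα.le
      have h2 : Continuous fun x : ℝ ↦ (1 - x) ^ β :=
        (continuous_const.sub continuous_id').rpow_const fun _ ↦ Or.inr hβ.le
      exact continuous_const.mul (h1.mul h2)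
    have hend (y : ℝ) (hy : Γ y = 0) (hy' : c * (y ^ α * (1 - y) ^ β) = 0) :
        ContinuousWithinAt (fun x ↦ Γ x * betaWeight α β x) (Icc 0 1) y := by
      have ht := (hlim.tendsto y).mono_left (nhdsWithin_le_nhds (s := Icc 0 1))
      rw [hy'] at ht
      rw [ContinuousWithinAt, hy, zero_mul]
      exact squeeze_zero_norm' (eventually_nhdsWithin_of_forall hprod) ht
    intro x hx
    rcases hx.1.eq_or_lt with rfl | h0
    · exact hend 0 hΓ0 (by simp [hα.ne'])
    rcases hx.2.eq_or_lt with rfl | h1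
    · exact hend 1 hΓ1 (by simp [hβ.ne'])
    exact (hΓ.continuousAt.mul
      (hasDerivAt_betaWeight α β ⟨h0, h1⟩).continuousAt).continuousWithinAt
  have hparts := MeasureTheory.integral_eq_of_hasDerivAt_off_countable_of_le
    (fun x ↦ Γ x * betaWeight α β x) (fun x ↦ γ x * betaWeight α β x + Γ x * w' x) zero_le_one hs
    hcont (fun x hx ↦ (hΓ' x hx).mul (hasDerivAt_betaWeight α β hx.1))
    ((intervalIntegrable_iff_integrableOn_Ioo_of_le zero_le_one).2 (hγw.add hΓw'))
  rw [intervalIntegral.integral_of_le zero_le_one, integral_Ioc_eq_integral_Ioo,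
    integral_add hγw hΓw', hΓ0, hΓ1, zero_mul, zero_mul, sub_zero] at hparts
  rw [eq_neg_of_add_eq_zero_left hparts, abs_neg, ← integral_const_mul]
  exact norm_integral_le_of_norm_le (f := fun x ↦ Γ x * w' x) (hdom.const_mul c)
    ((ae_restrict_mem measurableSet_Ioo).mono hbound)

lemma measurable_cellIndicator (N j : ℕ) : Measurable (cellIndicator N j) :=
  measurable_one.indicator measurableSet_Ioo

lemma abs_cellIndicator_le (N j : ℕ) (x : ℝ) : |cellIndicator N j x| ≤ 1 := by
  rw [cellIndicator, indicator_apply]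
  split_ifs <;> simp

lemma abs_eval_bernsteinPolynomial_le (n j : ℕ) {t : ℝ} (ht : t ∈ Icc (0 : ℝ) 1) :
    |(bernsteinPolynomial ℝ n j).eval t| ≤ 1 := by
  rw [abs_of_nonneg (eval_bernsteinPolynomial_nonneg n j ht)]
  rcases le_or_gt j n with h | h
  · rw [← sum_eval_bernsteinPolynomial n t]
    exact Finset.single_le_sum (fun i _ ↦ eval_bernsteinPolynomial_nonneg n i ht)
      (Finset.mem_range.2 (Nat.lt_succ_of_le h))
  · simp [bernsteinPolynomial.eq_zero_of_lt ℝ h]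

/-- Bernstein approximation of a Lipschitz function has mean error of order `1 / n` with respect to
the Beta density. -/
lemma abs_integral_bernstein_sub_le {α β : ℝ} (hα : 0 < α) (hβ : 0 < β) {n : ℕ} (hn : 1 ≤ n)
    {φ : ℝ → ℝ} (hφ : LipschitzWith 1 φ) :
    |∫ x in Ioo (0 : ℝ) 1, (∑ j ∈ Finset.range (n + 1),
        φ (j / n) * (bernsteinPolynomial ℝ n j).eval x - φ x) * betaWeight α β x| ≤
      (betaFun α β +
        (∫ x in Ioo (0 : ℝ) 1, |(α + β - 2) * x + (1 - α)| * betaWeight α β x) / 2) / n := by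
  have hn' : (0 : ℝ) < n := by exact_mod_cast hn
  set grid : Set ℝ := range fun j : ℕ ↦ (j : ℝ) / (n + 1 : ℕ) with hgrid
  have hcount : grid.Countable := countable_range _
  set γ : ℝ → ℝ := fun x ↦ ∑ j ∈ Finset.range (n + 1),
    φ (j / n) * ((bernsteinPolynomial ℝ n j).eval x - cellIndicator (n + 1) j x) with hγ
  set ρ : ℝ → ℝ := fun x ↦ ∑ j ∈ Finset.range (n + 1),
    φ (j / n) * cellIndicator (n + 1) j x - φ x with hρ
  have hγmeas : Measurable γ := by
    refine Finset.measurable_sum _ fun j _ ↦ Measurable.const_mul (Measurable.sub ?_ ?_) _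
    · exact (bernsteinPolynomial ℝ n j).continuous.measurable
    · exact measurable_cellIndicator _ _
  have hρmeas : Measurable ρ :=
    (Finset.measurable_sum _ fun j _ ↦ (measurable_cellIndicator _ _).const_mul _).sub
      hφ.continuous.measurable
  have hγM (x : ℝ) (hx : x ∈ Ioo (0 : ℝ) 1) :
      |γ x| ≤ ∑ j ∈ Finset.range (n + 1), |φ (j / n)| * (1 + 1) := by
    refine (Finset.abs_sum_le_sum_abs _ _).trans (Finset.sum_le_sum fun j _ ↦ ?_)
    rw [abs_mul]
    refine mul_le_mul_of_nonneg_left ((abs_sub _ _).trans ?_) (abs_nonneg _)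
    exact add_le_add (abs_eval_bernsteinPolynomial_le n j (Ioo_subset_Icc_self hx))
      (abs_cellIndicator_le _ _ _)
  have hwint := integrableOn_betaWeight hα hβ
  have hρM : ∀ᵐ x ∂volume.restrict (Ioo (0 : ℝ) 1), ‖ρ x‖ ≤ 1 / n := by
    filter_upwards [ae_restrict_mem measurableSet_Ioo,
      ae_restrict_of_ae (hcount.ae_notMem volume)] with x hx hxg
    exact abs_sum_cellIndicator_sub_le hn hφ (Ioo_subset_Icc_self hx) hxg
  have hγw : IntegrableOn (fun x ↦ γ x * betaWeight α β x) (Ioo 0 1) :=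
    hwint.bdd_mul hγmeas.aestronglyMeasurable ((ae_restrict_mem measurableSet_Ioo).mono hγM)
  have hρw : IntegrableOn (fun x ↦ ρ x * betaWeight α β x) (Ioo 0 1) :=
    hwint.bdd_mul hρmeas.aestronglyMeasurable hρM
  have hstep (j : ℕ) : |φ ((j + 1 : ℕ) / n) - φ (j / n)| ≤ 1 / n := by
    have h := hφ.dist_le_mul ((j + 1 : ℕ) / n) (j / n)
    have hd : ((j + 1 : ℕ) : ℝ) / n - j / n = 1 / n := by push_cast; ring
    rwa [NNReal.coe_one, one_mul, Real.dist_eq, Real.dist_eq, hd,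
      abs_of_pos (by positivity : (0 : ℝ) < 1 / n)] at h
  have hγle := abs_integral_deriv_mul_betaWeight_le hα hβ (c := 1 / n * (1 / 2)) hcount
    (continuous_bernsteinGap n fun j ↦ φ (j / n))
    (fun x hx ↦ hasDerivAt_bernsteinGap (fun j ↦ φ (j / n)) hx.2)
    (fun x hx ↦ (abs_bernsteinGap_le (by positivity) hstep hx).trans_eq (by ring)) hγmeas hγM
  have hρle : |∫ x in Ioo (0 : ℝ) 1, ρ x * betaWeight α β x| ≤ 1 / n * betaFun α β := by
    rw [betaFun_eq_integral_betaWeight, ← integral_const_mul]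
    refine norm_integral_le_of_norm_le (f := fun x ↦ ρ x * betaWeight α β x)
      (hwint.const_mul _) ?_
    filter_upwards [ae_restrict_mem measurableSet_Ioo, hρM] with x hx hxρ
    have hw := betaWeight_pos α β hx
    rw [norm_mul, Real.norm_of_nonneg hw.le]
    exact mul_le_mul_of_nonneg_right hxρ hw.le
  have hsplit : ∫ x in Ioo (0 : ℝ) 1, (∑ j ∈ Finset.range (n + 1),
        φ (j / n) * (bernsteinPolynomial ℝ n j).eval x - φ x) * betaWeight α β x =
      (∫ x in Ioo (0 : ℝ) 1, γ x * betaWeight α β x) +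
        ∫ x in Ioo (0 : ℝ) 1, ρ x * betaWeight α β x := by
    rw [← integral_add hγw hρw]
    refine integral_congr_ae (Filter.Eventually.of_forall fun x ↦ ?_)
    simp only [hγ, hρ, mul_sub, Finset.sum_sub_distrib]
    ring
  rw [hsplit]
  refine (abs_add_le _ _).trans ((add_le_add hγle hρle).trans_eq ?_)
  ring

lemma integral_barLaw {μ : Measure ℝ} {n : ℕ}
    (hμ : ∀ k, 0 ≤ ∫ t, t ^ k * (1 - t) ^ (n - k) ∂μ) (φ : ℝ → ℝ) :
    ∫ x, φ x ∂(barLaw μ n) = ∑ k ∈ Finset.range (n + 1),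
      ((n.choose k : ℝ) * ∫ t, t ^ k * (1 - t) ^ (n - k) ∂μ) * φ (k / n) := by
  rw [barLaw, integral_finsetSum_measure]
  · refine Finset.sum_congr rfl fun k _ ↦ ?_
    rw [integral_smul_measure, integral_dirac,
      ENNReal.toReal_ofReal (mul_nonneg (Nat.cast_nonneg _) (hμ k)), smul_eq_mul]
  · exact fun k _ ↦ (integrable_dirac (by simp)).smul_measure ENNReal.ofReal_ne_top

lemma integral_barLaw_betaM {α β : ℝ} (hα : 0 < α) (hβ : 0 < β) (n : ℕ) (φ : ℝ → ℝ) :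
    ∫ x, φ x ∂(barLaw (betaM α β) n) = (∫ x in Ioo (0 : ℝ) 1, (∑ j ∈ Finset.range (n + 1),
      φ (j / n) * (bernsteinPolynomial ℝ n j).eval x) * betaWeight α β x) / betaFun α β := by
  rw [integral_barLaw]
  · simp only [Finset.sum_mul]
    rw [integral_finsetSum, Finset.sum_div]
    · refine Finset.sum_congr rfl fun j _ ↦ ?_
      rw [integral_betaM hα hβ, mul_div_assoc', div_mul_eq_mul_div, ← integral_const_mul,
        ← integral_mul_const]
      simp only [eval_bernsteinPolynomial]
      congr 2 with x
      ring
    · exact fun j _ ↦ integrableOn_continuous_mul_betaWeight hα hβ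
        (continuous_const.mul (bernsteinPolynomial ℝ n j).continuous)
  · intro k
    rw [integral_betaM hα hβ]
    refine div_nonneg (setIntegral_nonneg measurableSet_Ioo fun x hx ↦ ?_) (betaFun_pos hα hβ).le
    have h0 := hx.1
    have h1 : 0 < 1 - x := sub_pos.2 hx.2
    have hw := betaWeight_pos α β hx
    positivity

lemma half_le_betaFun_div {α β : ℝ} (hα : 0 < α) (hβ : 0 < β) :
    1 / 2 ≤ (betaFun (α + 2) β + betaFun α (β + 2)) / betaFun α β := by
  rw [le_div_iff₀ (betaFun_pos hα hβ)]
  simp only [betaFun_eq_integral_betaWeight]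
  have h1 := integrableOn_betaWeight (add_pos hα two_pos) hβ
  have h2 := integrableOn_betaWeight hα (add_pos hβ two_pos)
  rw [← integral_add h1 h2, ← integral_const_mul]
  refine setIntegral_mono_on ((integrableOn_betaWeight hα hβ).const_mul _) (h1.add h2)
    measurableSet_Ioo fun x hx ↦ ?_
  have h0 := hx.1
  have h1 : 0 < 1 - x := sub_pos.2 hx.2
  have hw := betaWeight_pos α β hx
  have e1 : betaWeight (α + 2) β x = x ^ 2 * betaWeight α β x := by
    rw [betaWeight, betaWeight, add_sub_right_comm, Real.rpow_add h0, Real.rpow_two]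
    ring
  have e2 : betaWeight α (β + 2) x = (1 - x) ^ 2 * betaWeight α β x := by
    rw [betaWeight, betaWeight, add_sub_right_comm, Real.rpow_add h1, Real.rpow_two]
    ring
  rw [e1, e2]
  nlinarith [mul_nonneg (sq_nonneg (2 * x - 1)) hw.le]

lemma half_le_three_div_sqrt : 1 / 2 ≤ 3 / Real.sqrt (2 * Real.pi * Real.exp 1) := by
  have hpi := Real.pi_lt_four
  have he := Real.exp_one_lt_three
  have h : Real.sqrt (2 * Real.pi * Real.exp 1) ≤ 6 := by
    rw [Real.sqrt_le_left (by norm_num)]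
    nlinarith [Real.pi_pos, Real.exp_pos 1]
  rw [div_le_div_iff₀ two_pos (by positivity)]
  linarith

/-- When the mixing measure is `Beta(α,β)`, `d_W(X̄ₙ, θ) ≤ C_{α,β}/n`. -/
theorem stmt_7 (α β : ℝ) (hα : 0 < α) (hβ : 0 < β) (n : ℕ) (hn : 1 ≤ n) :
    dW (barLaw (betaM α β) n) (betaM α β) ≤
      ((betaFun (α + 2) β + betaFun α (β + 2)) / betaFun α β +
        (∫ x, |2 * x - 1| ∂(betaM α β)) +
        (∫ x, |(α + β - 2) * x + (1 - α)| ∂(betaM α β)) +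
        3 / Real.sqrt (2 * Real.pi * Real.exp 1)) / n := by
  have : Nonempty {f : ℝ → ℝ // LipschitzWith 1 f} := ⟨⟨id, LipschitzWith.id⟩⟩
  refine ciSup_le fun ⟨φ, hφ⟩ ↦ ?_
  have hB := betaFun_pos hα hβ
  have hbern := integrableOn_continuous_mul_betaWeight hα hβ
    (g := fun x ↦ ∑ j ∈ Finset.range (n + 1), φ (j / n) * (bernsteinPolynomial ℝ n j).eval x)
    (by fun_prop)
  have hφw := integrableOn_continuous_mul_betaWeight hα hβ hφ.continuous
  have hmain := abs_integral_bernstein_sub_le hα hβ hn hφ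
  simp only [sub_mul (Finset.sum _ _)] at hmain
  rw [integral_sub hbern hφw] at hmain
  have hdrift := integral_betaM hα hβ fun x ↦ |(α + β - 2) * x + (1 - α)|
  have hdrift_nonneg : 0 ≤ ∫ x, |(α + β - 2) * x + (1 - α)| ∂(betaM α β) :=
    integral_nonneg fun x ↦ abs_nonneg _
  have hmean_nonneg : 0 ≤ ∫ x, |2 * x - 1| ∂(betaM α β) := integral_nonneg fun x ↦ abs_nonneg _
  have h1 := half_le_betaFun_div hα hβ
  have h2 := half_le_three_div_sqrt
  rw [eq_div_iff hB.ne'] at hdrift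
  rw [← hdrift] at hmain
  rw [integral_barLaw_betaM hα hβ, integral_betaM hα hβ φ, ← sub_div, abs_div, abs_of_pos hB]
  calc _ ≤ (betaFun α β + (∫ x, |(α + β - 2) * x + (1 - α)| ∂(betaM α β)) * betaFun α β / 2) / n
        / betaFun α β := by gcongr
    _ = (1 + (∫ x, |(α + β - 2) * x + (1 - α)| ∂(betaM α β)) / 2) / n := by field_simp
    _ ≤ _ := div_le_div_of_nonneg_right (by linarith) (Nat.cast_nonneg n)
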